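/- Let b ≥ 2, s ≥ 1, and u ≥ 0 be integers and let e = (e_1,...,e_s) be an s-tuple of positive integers. Then any (u,e,s)-sequence in base b is a (t,s)-sequence in base b with t = u + Σ_{i=1}^s (e_i − 1). -/

import Mathlib

/-- `x ∈ [0,1)^s` lies in the elementary interval in base `b` determined by the
exponents `d` and numerators `a`, namely `∏_i [a i / b ^ d i, (a i + 1) / b ^ d i)`. -/
def MemElemInterval {s : ℕ} (b : ℕ) (d a : Fin s → ℕ) (x : Fin s → ℝ) : Prop :=
  ∀ i, (a i : ℝ) / (b : ℝ) ^ d i ≤ x i ∧ x i < ((a i : ℝ) + 1) / (b : ℝ) ^ d i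

/-- A `b`-adic interval of length `b ^ (-d)` contains each of its `b`-adic subintervals of length
`b ^ (-(d + δ))`. -/
lemma mem_interval_of_mem_subinterval {b : ℕ} (hb : 0 < b) {d δ a r : ℕ} {x : ℝ}
    (hr : r < b ^ δ)
    (hx : ((a * b ^ δ + r : ℕ) : ℝ) / (b : ℝ) ^ (d + δ) ≤ x ∧
      x < (((a * b ^ δ + r : ℕ) : ℝ) + 1) / (b : ℝ) ^ (d + δ)) :
    (a : ℝ) / (b : ℝ) ^ d ≤ x ∧ x < ((a : ℝ) + 1) / (b : ℝ) ^ d := by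
  have hb' : (0 : ℝ) < b := by exact_mod_cast hb
  have hδ : (0 : ℝ) < (b : ℝ) ^ δ := by positivity
  have hr' : (r : ℝ) + 1 ≤ (b : ℝ) ^ δ := by exact_mod_cast hr
  rw [div_le_iff₀ (by positivity), lt_div_iff₀ (by positivity), pow_add] at hx
  rw [div_le_iff₀ (by positivity), lt_div_iff₀ (by positivity)]
  push_cast at hx
  have hr0 : (0 : ℝ) ≤ r := by positivity
  constructor
  · refine le_of_mul_le_mul_right ?_ hδ
    linarith [hx.1]
  · refine lt_of_mul_lt_mul_right ?_ hδ.le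
    linarith [hx.2]

/-- A point of a `b`-adic interval of length `b ^ (-d)` lies in one of its `b`-adic subintervals
of length `b ^ (-(d + δ))`. -/
lemma exists_mem_subinterval {b : ℕ} (hb : 0 < b) {d δ a : ℕ} {x : ℝ}
    (hx : (a : ℝ) / (b : ℝ) ^ d ≤ x ∧ x < ((a : ℝ) + 1) / (b : ℝ) ^ d) :
    ∃ r : Fin (b ^ δ), ((a * b ^ δ + r : ℕ) : ℝ) / (b : ℝ) ^ (d + δ) ≤ x ∧
      x < (((a * b ^ δ + r : ℕ) : ℝ) + 1) / (b : ℝ) ^ (d + δ) := by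
  have hb' : (0 : ℝ) < b := by exact_mod_cast hb
  have hδ : (0 : ℝ) < (b : ℝ) ^ δ := by positivity
  have hx0 : 0 ≤ x := le_trans (by positivity) hx.1
  rw [div_le_iff₀ (by positivity), lt_div_iff₀ (by positivity)] at hx
  have hlow : a * b ^ δ ≤ ⌊x * (b : ℝ) ^ (d + δ)⌋₊ := by
    apply Nat.le_floor
    push_cast
    rw [pow_add, ← mul_assoc]
    exact mul_le_mul_of_nonneg_right hx.1 hδ.le
  have hupp : ⌊x * (b : ℝ) ^ (d + δ)⌋₊ < (a + 1) * b ^ δ := by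
    rw [Nat.floor_lt (by positivity)]
    push_cast
    rw [pow_add, ← mul_assoc]
    exact mul_lt_mul_of_pos_right hx.2 hδ
  rw [add_mul, one_mul] at hupp
  refine ⟨⟨⌊x * (b : ℝ) ^ (d + δ)⌋₊ - a * b ^ δ, by omega⟩, ?_⟩
  simp only [Nat.add_sub_cancel' hlow]
  rw [div_le_iff₀ (by positivity), lt_div_iff₀ (by positivity)]
  exact ⟨Nat.floor_le (by positivity), Nat.lt_floor_add_one _⟩

/-- Distinct `b`-adic intervals of the same length are disjoint. -/
lemma interval_numerator_unique {b : ℕ} (hb : 0 < b) {d p q : ℕ} {x : ℝ}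
    (hp : (p : ℝ) / (b : ℝ) ^ d ≤ x ∧ x < ((p : ℝ) + 1) / (b : ℝ) ^ d)
    (hq : (q : ℝ) / (b : ℝ) ^ d ≤ x ∧ x < ((q : ℝ) + 1) / (b : ℝ) ^ d) : p = q := by
  have hb' : (0 : ℝ) < b := by exact_mod_cast hb
  rw [div_le_iff₀ (by positivity), lt_div_iff₀ (by positivity)] at hp hq
  have hpq : p < q + 1 := by exact_mod_cast hp.1.trans_lt hq.2
  have hqp : q < p + 1 := by exact_mod_cast hq.1.trans_lt hp.2
  omega

/-- If every elementary subinterval with exponents `d + δ` of an elementary interval with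
exponents `d` contains `N` of the points `x n`, then the interval contains
`b ^ (∑ i, δ i) * N` of them. -/
lemma card_memElemInterval_of_refinement {ι : Type*} [Finite ι] {b s : ℕ} (hb : 0 < b)
    (x : ι → Fin s → ℝ) (d δ a : Fin s → ℕ) (N : ℕ)
    (h : ∀ r : ∀ i, Fin (b ^ δ i),
      Nat.card {n // MemElemInterval b (fun i => d i + δ i)
        (fun i => a i * b ^ δ i + r i) (x n)} = N) :
    Nat.card {n // MemElemInterval b d a (x n)} = b ^ (∑ i, δ i) * N := by
  let f : (Σ r : ∀ i, Fin (b ^ δ i), {n // MemElemInterval b (fun i => d i + δ i)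
      (fun i => a i * b ^ δ i + r i) (x n)}) → {n // MemElemInterval b d a (x n)} :=
    fun p => ⟨p.2.1, fun i => mem_interval_of_mem_subinterval hb (p.1 i).2 (p.2.2 i)⟩
  have hf : Function.Bijective f := by
    constructor
    · rintro ⟨r, n, hn⟩ ⟨r', n', hn'⟩ heq
      obtain rfl : n = n' := congrArg Subtype.val heq
      obtain rfl : r = r' := by
        funext i
        have := interval_numerator_unique hb (hn i) (hn' i)
        exact Fin.ext (Nat.add_left_cancel this)
      rfl
    · rintro ⟨n, hn⟩
      choose r hr using fun i => exists_mem_subinterval (δ := δ i) hb (hn i)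
      exact ⟨⟨r, n, hr⟩, rfl⟩
  rw [← Nat.card_congr (Equiv.ofBijective f hf), Nat.card_sigma, Finset.sum_congr rfl
    fun r _ => h r]
  simp [Finset.prod_pow_eq_pow_sum]

/-- Any `(u, e, s)`-sequence in base `b` is a `(t, s)`-sequence in base `b` with
`t = u + ∑ i (e i - 1)`.  The sequence of points in `[0,1]^s` is represented by its
prescribed `b`-adic digits `D n i j` (the digit of weight `b ^ (-(j+1))` of the `i`-th
coordinate of the `n`-th point); the `m`-digit truncation of the `i`-th coordinate of
the `n`-th point is `∑_{j < m} D n i j / b ^ (j+1)`, and a `(u, e, s)`-sequence is one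
all of whose truncated `b ^ m`-blocks (for `m > u`) are `(u, m, e, s)`-nets. -/
theorem stmt1 (b s u : ℕ) (hb : 2 ≤ b) (hs : 1 ≤ s)
    (e : Fin s → ℕ) (he : ∀ i, 1 ≤ e i)
    (D : ℕ → Fin s → ℕ → ℕ) (hD : ∀ n i j, D n i j < b)
    (hseq : ∀ k m : ℕ, u < m → ∀ d a : Fin s → ℕ, (∀ i, e i ∣ d i) →
      (∀ i, a i < b ^ d i) → u + ∑ i, d i ≤ m →
      Nat.card {n : Fin (b ^ m) // MemElemInterval b d a (fun i =>
          ∑ j ∈ Finset.range m, (D (k * b ^ m + (n : ℕ)) i j : ℝ) / (b : ℝ) ^ (j + 1))}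
        = b ^ (m - ∑ i, d i)) :
    ∀ k m : ℕ, u + ∑ i, (e i - 1) < m → ∀ d a : Fin s → ℕ,
      (∀ i, a i < b ^ d i) → (u + ∑ i, (e i - 1)) + ∑ i, d i ≤ m →
      Nat.card {n : Fin (b ^ m) // MemElemInterval b d a (fun i =>
          ∑ j ∈ Finset.range m, (D (k * b ^ m + (n : ℕ)) i j : ℝ) / (b : ℝ) ^ (j + 1))}
        = b ^ (m - ∑ i, d i) := by
  intro k m hm d a ha hd
  have hb0 : 0 < b := by omega
  have hround : ∀ i, ∃ δ, δ ≤ e i - 1 ∧ e i ∣ d i + δ := by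
    intro i
    have hmod := Nat.div_add_mod (d i + (e i - 1)) (e i)
    have hlt := Nat.mod_lt (d i + (e i - 1)) (he i)
    refine ⟨e i - 1 - (d i + (e i - 1)) % e i, Nat.sub_le _ _,
      (d i + (e i - 1)) / e i, by omega⟩
  choose δ hδ hdvd using hround
  have hsum : ∑ i, δ i ≤ ∑ i, (e i - 1) := Finset.sum_le_sum fun i _ => hδ i
  have hadd : ∑ i, (d i + δ i) = ∑ i, d i + ∑ i, δ i := Finset.sum_add_distrib
  rw [card_memElemInterval_of_refinement hb0 _ d δ a (b ^ (m - ∑ i, (d i + δ i))) fun r =>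
    hseq k m (by omega) _ _ hdvd (fun i => ?_) (by omega), ← pow_add]
  · congr 1
    omega
  · have hle : (a i + 1) * b ^ δ i ≤ b ^ d i * b ^ δ i := Nat.mul_le_mul_right _ (ha i)
    rw [pow_add]
    have := (r i).2
    linarith
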